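/- (A one-homogeneous solution of a uniformly elliptic equation in ℝ⁴) Let v : ℝ⁴ \ {0} → ℝ be defined by v(x₁,x₂,x₃,x₄) = (x₁² + x₂² − x₃² − x₄²)/|x|, where |x| is the Euclidean norm. Then there exist λ ∈ (0,1] and a map a assigning to each x ∈ ℝ⁴ \ {0} a symmetric 4×4 real matrix with λ|ξ|² ≤ ξ·a(x)ξ ≤ λ⁻¹|ξ|² for all ξ ∈ ℝ⁴, such that tr(a(x) D²v(x)) = 0 for all x ≠ 0. -/

import Mathlib

noncomputable section

/-- The second partial derivative `∂_i ∂_j v (x)`. -/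
def secondPartial {n : ℕ} (v : EuclideanSpace ℝ (Fin n) → ℝ)
    (x : EuclideanSpace ℝ (Fin n)) (i j : Fin n) : ℝ :=
  fderiv ℝ (fun y => fderiv ℝ v y (EuclideanSpace.single j 1)) x (EuclideanSpace.single i 1)

/-- The one-homogeneous function `v(x) = (x₁² + x₂² − x₃² − x₄²)/|x|` on `ℝ⁴`. -/
def vFun (x : EuclideanSpace ℝ (Fin 4)) : ℝ :=
  (x 0 ^ 2 + x 1 ^ 2 - x 2 ^ 2 - x 3 ^ 2) / ‖x‖

theorem hasFDerivAt_inv_norm {x : EuclideanSpace ℝ (Fin 4)} (hx : x ≠ 0) :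
    HasFDerivAt (fun y : EuclideanSpace ℝ (Fin 4) => ‖y‖⁻¹)
      (-(‖x‖ ^ 3)⁻¹ • innerSL ℝ x) x := by
  have hpos : 0 < ‖x‖ := norm_pos_iff.mpr hx
  have hs : √(‖x‖ ^ 2) ≠ 0 := by positivity
  have h := (hasDerivAt_inv hs).comp_hasFDerivAt x
    ((hasStrictFDerivAt_norm_sq x).hasFDerivAt.sqrt (by positivity))
  simp only [Function.comp_def, Real.sqrt_sq (norm_nonneg _)] at h
  refine h.congr_fderiv ?_
  ext y
  simp
  field_simp

theorem hasFDerivAt_coord (i : Fin 4) (x : EuclideanSpace ℝ (Fin 4)) :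
    HasFDerivAt (fun y : EuclideanSpace ℝ (Fin 4) => y i)
      (EuclideanSpace.proj i : EuclideanSpace ℝ (Fin 4) →L[ℝ] ℝ) x :=
  (EuclideanSpace.proj i : EuclideanSpace ℝ (Fin 4) →L[ℝ] ℝ).hasFDerivAt

/-- The signs of the quadratic form `x₁² + x₂² − x₃² − x₄²`. -/
def formSign : Fin 4 → ℝ := ![1, 1, -1, -1]

/-- The quadratic form `x₁² + x₂² − x₃² − x₄²`. -/
def splitForm (x : EuclideanSpace ℝ (Fin 4)) : ℝ :=
  x 0 ^ 2 + x 1 ^ 2 - x 2 ^ 2 - x 3 ^ 2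

theorem differentiableAt_splitForm (x : EuclideanSpace ℝ (Fin 4)) :
    DifferentiableAt ℝ splitForm x := by
  have h (i : Fin 4) := (hasFDerivAt_coord i x).differentiableAt
  exact ((((h 0).pow 2).add ((h 1).pow 2)).sub ((h 2).pow 2)).sub ((h 3).pow 2)

theorem fderiv_splitForm_single (x : EuclideanSpace ℝ (Fin 4)) (j : Fin 4) :
    fderiv ℝ splitForm x (EuclideanSpace.single j 1) = 2 * formSign j * x j := by
  have h (i : Fin 4) := (hasFDerivAt_coord i x).pow 2
  have h' : HasFDerivAt splitForm _ x := (((h 0).add (h 1)).sub (h 2)).sub (h 3)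
  rw [h'.fderiv]
  fin_cases j <;> simp [formSign]

theorem fderiv_vFun_single {x : EuclideanSpace ℝ (Fin 4)} (hx : x ≠ 0) (j : Fin 4) :
    fderiv ℝ vFun x (EuclideanSpace.single j 1) =
      2 * formSign j * x j * ‖x‖⁻¹ - splitForm x * x j * ‖x‖⁻¹ ^ 3 := by
  have hv : vFun = fun y => splitForm y * ‖y‖⁻¹ := funext fun y => div_eq_mul_inv _ _
  have h : HasFDerivAt (fun y => splitForm y * ‖y‖⁻¹) _ x :=
    (differentiableAt_splitForm x).hasFDerivAt.mul (hasFDerivAt_inv_norm hx)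
  rw [hv, h.fderiv]
  simp [fderiv_splitForm_single, EuclideanSpace.inner_single_right]
  ring

theorem secondPartial_vFun_diag {x : EuclideanSpace ℝ (Fin 4)} (hx : x ≠ 0) (j : Fin 4) :
    secondPartial vFun x j j =
      2 * formSign j * ‖x‖⁻¹ - 4 * formSign j * x j ^ 2 * ‖x‖⁻¹ ^ 3
        - splitForm x * ‖x‖⁻¹ ^ 3 + 3 * splitForm x * x j ^ 2 * ‖x‖⁻¹ ^ 5 := by
  have heq : (fun y => fderiv ℝ vFun y (EuclideanSpace.single j 1)) =ᶠ[nhds x]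
      fun y => 2 * formSign j * y j * ‖y‖⁻¹ - splitForm y * y j * ‖y‖⁻¹ ^ 3 := by
    filter_upwards [isOpen_ne.mem_nhds hx] with y hy using fderiv_vFun_single hy j
  have hc := hasFDerivAt_coord j x
  have hn := hasFDerivAt_inv_norm hx
  have h := ((hc.const_mul (2 * formSign j)).fun_mul hn).fun_sub
    (((differentiableAt_splitForm x).hasFDerivAt.fun_mul hc).fun_mul (hn.pow 3))
  rw [secondPartial, heq.fderiv_eq, h.fderiv]
  simp [fderiv_splitForm_single, EuclideanSpace.inner_single_right]
  ring

/-- The coefficient of the diagonal matrix `a` on a coordinate plane in which the point has squared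
norm `s`, the squared norm in the complementary plane being `t`. -/
def planeCoeff (s t : ℝ) : ℝ := (6 * s ^ 2 + s * t + t ^ 2) / (s + t) ^ 2

theorem planeCoeff_bounds {s t : ℝ} (hs : 0 ≤ s) (ht : 0 ≤ t) (h : 0 < s + t) :
    1 / 6 ≤ planeCoeff s t ∧ planeCoeff s t ≤ 6 := by
  have hst := mul_nonneg hs ht
  rw [planeCoeff, le_div_iff₀ (by positivity), div_le_iff₀ (by positivity)]
  constructor <;> nlinarith [sq_nonneg s, sq_nonneg t]

theorem norm_sq_eq_add (x : EuclideanSpace ℝ (Fin 4)) :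
    ‖x‖ ^ 2 = (x 0 ^ 2 + x 1 ^ 2) + (x 2 ^ 2 + x 3 ^ 2) := by
  rw [EuclideanSpace.real_norm_sq_eq, Fin.sum_univ_four]
  ring

theorem secondPartial_vFun_plane {x : EuclideanSpace ℝ (Fin 4)} (hx : x ≠ 0) :
    secondPartial vFun x 0 0 + secondPartial vFun x 1 1 =
        planeCoeff (x 2 ^ 2 + x 3 ^ 2) (x 0 ^ 2 + x 1 ^ 2) * ‖x‖⁻¹ ∧
      secondPartial vFun x 2 2 + secondPartial vFun x 3 3 =
        -(planeCoeff (x 0 ^ 2 + x 1 ^ 2) (x 2 ^ 2 + x 3 ^ 2) * ‖x‖⁻¹) := by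
  have hpos : ‖x‖ ≠ 0 := norm_ne_zero_iff.mpr hx
  have hr := norm_sq_eq_add x
  have hr' : ‖x‖ ^ 4 = ((x 0 ^ 2 + x 1 ^ 2) + (x 2 ^ 2 + x 3 ^ 2)) ^ 2 := by
    rw [← hr]
    ring
  simp only [secondPartial_vFun_diag hx, planeCoeff]
  rw [add_comm (x 2 ^ 2 + x 3 ^ 2), ← hr]
  simp only [formSign, splitForm, Matrix.cons_val]
  constructor <;>
  · field_simp
    ring_nf
    rw [hr', hr]
    ring

/-- `v(x) = (x₁² + x₂² − x₃² − x₄²)/|x|` solves a linear uniformly elliptic equation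
`tr(a(x) D²v(x)) = 0` away from the origin in `ℝ⁴`. -/
theorem one_homogeneous_solution_dim4 :
    ∃ lam : ℝ, lam ∈ Set.Ioc (0 : ℝ) 1 ∧
      ∃ a : EuclideanSpace ℝ (Fin 4) → Matrix (Fin 4) (Fin 4) ℝ,
        (∀ x : EuclideanSpace ℝ (Fin 4), x ≠ 0 → (a x).IsSymm) ∧
        (∀ x : EuclideanSpace ℝ (Fin 4), x ≠ 0 →
          ∀ ξ : EuclideanSpace ℝ (Fin 4),
            lam * ‖ξ‖ ^ 2 ≤ ∑ i, ∑ j, ξ i * a x i j * ξ j ∧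
              ∑ i, ∑ j, ξ i * a x i j * ξ j ≤ lam⁻¹ * ‖ξ‖ ^ 2) ∧
        (∀ x : EuclideanSpace ℝ (Fin 4), x ≠ 0 →
          ∑ i, ∑ j, a x i j * secondPartial vFun x i j = 0) := by
  refine ⟨1 / 6, by norm_num, fun x => Matrix.diagonal
    ![planeCoeff (x 0 ^ 2 + x 1 ^ 2) (x 2 ^ 2 + x 3 ^ 2),
      planeCoeff (x 0 ^ 2 + x 1 ^ 2) (x 2 ^ 2 + x 3 ^ 2),
      planeCoeff (x 2 ^ 2 + x 3 ^ 2) (x 0 ^ 2 + x 1 ^ 2),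
      planeCoeff (x 2 ^ 2 + x 3 ^ 2) (x 0 ^ 2 + x 1 ^ 2)],
    fun x _ => Matrix.isSymm_diagonal _, fun x hx ξ => ?_, fun x hx => ?_⟩
  · have hpos : 0 < ‖x‖ ^ 2 := pow_pos (norm_pos_iff.mpr hx) 2
    rw [norm_sq_eq_add] at hpos
    obtain ⟨hA, hA'⟩ := planeCoeff_bounds (s := x 0 ^ 2 + x 1 ^ 2) (t := x 2 ^ 2 + x 3 ^ 2)
      (by positivity) (by positivity) hpos
    obtain ⟨hB, hB'⟩ := planeCoeff_bounds (s := x 2 ^ 2 + x 3 ^ 2) (t := x 0 ^ 2 + x 1 ^ 2)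
      (by positivity) (by positivity) (by rwa [add_comm])
    have hp : 0 ≤ ξ 0 ^ 2 + ξ 1 ^ 2 := by positivity
    have hq : 0 ≤ ξ 2 ^ 2 + ξ 3 ^ 2 := by positivity
    rw [norm_sq_eq_add ξ]
    simp only [Matrix.diagonal_apply, mul_ite, ite_mul, mul_zero, zero_mul,
      Finset.sum_ite_eq, Finset.mem_univ, if_true, Fin.sum_univ_four, Matrix.cons_val]
    constructor
    · linarith [mul_le_mul_of_nonneg_right hA hp, mul_le_mul_of_nonneg_right hB hq]
    · linarith [mul_le_mul_of_nonneg_right hA' hp, mul_le_mul_of_nonneg_right hB' hq]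
  · obtain ⟨h1, h2⟩ := secondPartial_vFun_plane hx
    simp only [Matrix.diagonal_apply, ite_mul, zero_mul,
      Finset.sum_ite_eq, Finset.mem_univ, if_true, Fin.sum_univ_four, Matrix.cons_val]
    linear_combination planeCoeff (x 0 ^ 2 + x 1 ^ 2) (x 2 ^ 2 + x 3 ^ 2) * h1 +
      planeCoeff (x 2 ^ 2 + x 3 ^ 2) (x 0 ^ 2 + x 1 ^ 2) * h2
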